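/- Let m ≥ 3 be odd. Suppose a strongly regular graph Γ with parameters (4m², 2m²+m, m²+m, m²+m) is locally 3-isoregular at a vertex x, with associated edge parameters Q,R,W and non-edge parameters R,W,V. Then R = m², Q = 2m-1, W = m+1, V = m(m+1), and consequently Γ contains a clique of size m²+1, contradicting the Hoffman bound 1 + (2m²+m)/m = 2m+2. Hence no such locally 3-isoregular graph exists. -/

import Mathlib

open Finset

variable {V : Type*}

/-- The number of common neighbors of the three vertices `x, y, z` in `G`. -/
def commonValency [Fintype V] [DecidableEq V] (G : SimpleGraph V)
    [DecidableRel G.Adj] (x y z : V) : ℕ :=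
  (G.neighborFinset x ∩ G.neighborFinset y ∩ G.neighborFinset z).card

/-- `(x,y)` is a 3-isoregular edge of `G` with associated parameters `Q, R, W`:
the number of common neighbors of `{x,y,z}` equals `Q`, `R` or `W` according
to whether the induced subgraph on `{x,y,z}` is `K₃`, `K_{1,2}` or `K₂ + K₁`. -/
def IsoregEdgeWith [Fintype V] [DecidableEq V] (G : SimpleGraph V)
    [DecidableRel G.Adj] (x y : V) (Q R W : ℕ) : Prop :=
  G.Adj x y ∧
  (∀ z, z ≠ x → z ≠ y → G.Adj z x → G.Adj z y → commonValency G x y z = Q) ∧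
  (∀ z, z ≠ x → z ≠ y → Xor' (G.Adj z x) (G.Adj z y) → commonValency G x y z = R) ∧
  (∀ z, z ≠ x → z ≠ y → ¬ G.Adj z x → ¬ G.Adj z y → commonValency G x y z = W)

/-- `(x,z)` is a 3-isoregular non-edge of `G` with associated parameters
`R', W', V'`: the number of common neighbors of `{x,z,u}` equals `R'`, `W'`
or `V'` according to whether the induced subgraph on `{x,z,u}` is `K_{1,2}`,
`K₂ + K₁` or `3K₁`. -/
def IsoregNonEdgeWith [Fintype V] [DecidableEq V] (G : SimpleGraph V)
    [DecidableRel G.Adj] (x z : V) (R' W' V' : ℕ) : Prop :=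
  x ≠ z ∧ ¬ G.Adj x z ∧
  (∀ u, u ≠ x → u ≠ z → G.Adj u x → G.Adj u z → commonValency G x z u = R') ∧
  (∀ u, u ≠ x → u ≠ z → Xor' (G.Adj u x) (G.Adj u z) → commonValency G x z u = W') ∧
  (∀ u, u ≠ x → u ≠ z → ¬ G.Adj u x → ¬ G.Adj u z → commonValency G x z u = V')

section Counting

variable [Fintype V] [DecidableEq V] (G : SimpleGraph V) [DecidableRel G.Adj]

theorem commonValency_eq_card_neighborFinset_inter (x y z : V) :
    commonValency G x y z =
      (G.neighborFinset z ∩ (G.neighborFinset x ∩ G.neighborFinset y)).card := by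
  rw [commonValency, inter_comm]

theorem sum_card_neighborFinset_inter_comm (S T : Finset V) :
    ∑ v ∈ T, (G.neighborFinset v ∩ S).card = ∑ v ∈ S, (G.neighborFinset v ∩ T).card := by
  have key := sum_card_bipartiteAbove_eq_sum_card_bipartiteBelow (s := T) (t := S) G.Adj
  convert key using 2 with v _ v _
  · congr 1; ext w; simp [bipartiteAbove, and_comm]
  · congr 1; ext w; simp [bipartiteBelow, and_comm, G.adj_comm]

theorem sum_card_neighborFinset_inter_sq (S : Finset V) :
    ∑ v, (G.neighborFinset v ∩ S).card ^ 2 =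
      ∑ s ∈ S, ∑ t ∈ S, (G.neighborFinset s ∩ G.neighborFinset t).card := by
  have h1 (v : V) : (G.neighborFinset v ∩ S).card = ∑ s ∈ S, if G.Adj s v then 1 else 0 := by
    rw [sum_boole, Nat.cast_id]
    congr 1; ext w; simp [and_comm, G.adj_comm]
  have h2 (s t : V) : (G.neighborFinset s ∩ G.neighborFinset t).card =
      ∑ v, (if G.Adj s v then 1 else 0) * (if G.Adj t v then 1 else 0) := by
    simp only [← ite_and, mul_ite, mul_one, mul_zero]
    rw [sum_boole, Nat.cast_id]
    congr 1; ext w; simp [and_comm]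
  simp only [h1, h2, sq, sum_mul_sum]
  rw [sum_comm]
  exact sum_congr rfl fun s _ => sum_comm

variable {G} {n k l : ℕ}

theorem SimpleGraph.IsSRGWith.card_neighborFinset_inter (h : G.IsSRGWith n k l l)
    {x y : V} (hne : x ≠ y) : (G.neighborFinset x ∩ G.neighborFinset y).card = l := by
  have key : Fintype.card (G.commonNeighbors x y) = l := by
    by_cases hadj : G.Adj x y
    · exact h.of_adj x y hadj
    · exact h.of_not_adj hne hadj
  rw [← key, ← Set.toFinset_card]
  congr 1; ext w; simp [SimpleGraph.mem_commonNeighbors]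

/-- The bound on a vertex set inducing an `e`-regular subgraph of a strongly regular graph with
`λ = μ = l`, obtained from the Cauchy-Schwarz inequality. -/
theorem SimpleGraph.IsSRGWith.regular_induced_bound (h : G.IsSRGWith n k l l)
    (S : Finset V) {e : ℕ} (hS : ∀ v ∈ S, (G.neighborFinset v ∩ S).card = e) :
    ((k : ℤ) * S.card - S.card * e) ^ 2 ≤
      (n - S.card) * (S.card * k + S.card * (S.card - 1) * l - S.card * e ^ 2) := by
  have hdeg (v : V) : (G.neighborFinset v).card = k := by
    rw [G.card_neighborFinset_eq_degree]; exact h.regular v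
  have hsum : ∑ v ∈ Sᶜ, ((G.neighborFinset v ∩ S).card : ℤ) = k * S.card - S.card * e := by
    have h1 := sum_card_neighborFinset_inter_comm G S univ
    simp only [inter_univ, hdeg, sum_const, smul_eq_mul] at h1
    rw [← sum_compl_add_sum S, sum_const_nat hS] at h1
    zify at h1
    linarith
  have hsq : ∑ v ∈ Sᶜ, ((G.neighborFinset v ∩ S).card : ℤ) ^ 2 =
      S.card * k + S.card * (S.card - 1) * l - S.card * e ^ 2 := by
    have h1 := sum_card_neighborFinset_inter_sq G S
    have h2 : ∀ s ∈ S, ∑ t ∈ S, (G.neighborFinset s ∩ G.neighborFinset t).card =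
        k + (S.card - 1) * l := by
      intro s hs
      rw [← add_sum_erase S _ hs, inter_self, hdeg, ← card_erase_of_mem hs]
      congr 1
      exact sum_const_nat fun t ht =>
        h.card_neighborFinset_inter (ne_of_mem_erase ht).symm
    rw [sum_const_nat h2, ← sum_compl_add_sum S,
      sum_const_nat (s := S) (m := e ^ 2) (fun v hv => by rw [hS v hv])] at h1
    rcases Nat.eq_zero_or_pos S.card with h0 | h0
    · simp [card_eq_zero.1 h0]
    · zify [h0] at h1
      linarith
  have hcard : ((Sᶜ).card : ℤ) = n - S.card := by
    have h1 := card_compl_add_card S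
    rw [h.card] at h1
    omega
  have hcs := sq_sum_le_card_mul_sum_sq (s := Sᶜ)
    (f := fun v => ((G.neighborFinset v ∩ S).card : ℤ))
  rwa [hsum, hsq, hcard] at hcs

end Counting

theorem isoreg_parameter_cases {m Q R W Vp : ℕ} (hodd : Odd m) (hm : 3 ≤ m)
    (edge_eq : ((m : ℤ) ^ 2 + m) * Q + (m ^ 2 - 1) * R + (m ^ 2 + m) = (m ^ 2 + m) ^ 2)
    (nonedge_eq : ((m : ℤ) ^ 2 + m) * R + m ^ 2 * W = (m ^ 2 + m) ^ 2)
    (outer_eq : 2 * ((m : ℤ) ^ 2 + m) + (m ^ 2 - m - 2) * Vp =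
      (2 * m ^ 2 + m) * (m ^ 2 + m) - 2 * (m ^ 2 + m) ^ 2 + (m ^ 2 + m) * R)
    (hVle : (Vp : ℤ) ≤ m ^ 2 + m) : Vp = m ∨ W = m + 1 := by
  have hm' : (3 : ℤ) ≤ m := by exact_mod_cast hm
  obtain ⟨r, hr⟩ : ∃ r : ℤ, (R : ℤ) = m * r := by
    refine ⟨Q + R + 1 - m ^ 2 - m, ?_⟩
    have : (m + 1 : ℤ) ≠ 0 := by omega
    apply mul_left_cancel₀ this
    linarith
  have hVr : ((m : ℤ) - 2) * Vp = m * (m * r - m - 2) := by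
    have : (m + 1 : ℤ) ≠ 0 := by omega
    apply mul_left_cancel₀ this
    rw [hr] at outer_eq
    linarith
  obtain ⟨q, hq⟩ : (m : ℤ) - 2 ∣ r - 2 := by
    obtain ⟨j, hj⟩ := hodd
    have hj' : (m : ℤ) = 2 * j + 1 := by exact_mod_cast hj
    have hcop : IsCoprime ((m : ℤ) - 2) 4 := by
      have h2 : IsCoprime ((m : ℤ) - 2) 2 := ⟨-1, j, by rw [hj']; ring⟩
      have := h2.pow_right (n := 2)
      norm_num at this
      exact this
    refine hcop.dvd_of_dvd_mul_left ⟨Vp - (m + 2) * r + (m + 4) , ?_⟩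
    linarith
  have hVq : (Vp : ℤ) = m * (m * q + 1) := by
    have : (m - 2 : ℤ) ≠ 0 := by omega
    apply mul_left_cancel₀ this
    rw [hVr, show r = (m - 2) * q + 2 by linarith]
    ring
  have hV0 : (0 : ℤ) ≤ Vp := by positivity
  have hq0 : 0 ≤ q := by
    by_contra! hlt
    have h1 : m * q + 1 < 0 := by nlinarith
    nlinarith
  have hq1 : q ≤ 1 := by
    by_contra! hlt
    have h1 : m * q + 1 > (m : ℤ) + 1 := by nlinarith
    nlinarith
  obtain rfl | rfl : q = 0 ∨ q = 1 := by omega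
  · left
    zify
    linarith
  · right
    have : (m : ℤ) ^ 2 ≠ 0 := by positivity
    zify
    apply mul_left_cancel₀ this
    rw [hr, show r = m by linarith] at nonedge_eq
    linarith

theorem coclique_size_violates_bound {m : ℤ} (hm : 3 ≤ m) :
    (4 * m ^ 2 - (m ^ 2 - m)) * ((m ^ 2 - m) * (2 * m ^ 2 + m) +
      (m ^ 2 - m) * (m ^ 2 - m - 1) * (m ^ 2 + m) - (m ^ 2 - m) * 0 ^ 2) <
      ((2 * m ^ 2 + m) * (m ^ 2 - m) - (m ^ 2 - m) * 0) ^ 2 := by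
  obtain ⟨t, rfl⟩ : ∃ t : ℤ, m = t + 3 := ⟨m - 3, by ring⟩
  have ht0 : 0 ≤ t := by omega
  ring_nf
  linarith [pow_nonneg ht0 2, pow_nonneg ht0 3, pow_nonneg ht0 4, pow_nonneg ht0 5,
    pow_nonneg ht0 6, pow_nonneg ht0 7, pow_nonneg ht0 8, pow_nonneg ht0 9, pow_nonneg ht0 10]

theorem clique_size_violates_bound {m : ℤ} (hm : 3 ≤ m) :
    (4 * m ^ 2 - (m ^ 2 + 1)) * ((m ^ 2 + 1) * (2 * m ^ 2 + m) +
      (m ^ 2 + 1) * (m ^ 2 + 1 - 1) * (m ^ 2 + m) - (m ^ 2 + 1) * (m ^ 2) ^ 2) <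
      ((2 * m ^ 2 + m) * (m ^ 2 + 1) - (m ^ 2 + 1) * m ^ 2) ^ 2 := by
  obtain ⟨t, rfl⟩ : ∃ t : ℤ, m = t + 3 := ⟨m - 3, by ring⟩
  have ht0 : 0 ≤ t := by omega
  ring_nf
  linarith [pow_nonneg ht0 2, pow_nonneg ht0 3, pow_nonneg ht0 4, pow_nonneg ht0 5,
    pow_nonneg ht0 6, pow_nonneg ht0 7, pow_nonneg ht0 8, pow_nonneg ht0 9, pow_nonneg ht0 10]

/-- For odd `m ≥ 3`, if a strongly regular graph with
parameters `(4m², 2m²+m, m²+m, m²+m)` were locally 3-isoregular at a vertex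
`x`, with 3-isoregular edge `(x,y)` having parameters `Q,R,W` and
3-isoregular non-edge `(x,z)` having parameters `R,W,V`, then `R = m²`,
`Q = 2m-1`, `W = m+1`, `V = m(m+1)`, and this yields a clique of size `m²+1`
contradicting the Hoffman bound; hence no such graph exists. -/
theorem no_family_c_locally_isoreg [Fintype V] [DecidableEq V]
    (G : SimpleGraph V) [DecidableRel G.Adj] (m : ℕ) (hodd : Odd m)
    (hm : 3 ≤ m)
    (h : G.IsSRGWith (4 * m ^ 2) (2 * m ^ 2 + m) (m ^ 2 + m) (m ^ 2 + m))
    (x y z : V) (Q R W Vp : ℕ)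
    (hxy : IsoregEdgeWith G x y Q R W)
    (hxz : IsoregNonEdgeWith G x z R W Vp) :
    R = m ^ 2 ∧ Q = 2 * m - 1 ∧ W = m + 1 ∧ Vp = m * (m + 1) ∧ False := by
  exfalso
  have hdeg (v : V) : (G.neighborFinset v).card = 2 * m ^ 2 + m := by
    rw [G.card_neighborFinset_eq_degree]; exact h.regular v
  obtain ⟨hadj, hQ, hR, -⟩ := hxy
  obtain ⟨hne, hnadj, hR', hW, hV⟩ := hxz
  simp only [commonValency_eq_card_neighborFinset_inter] at hQ hR hR' hW hV
  have hyx : y ≠ x := hadj.ne'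
  have hpair (S : Finset V) (v : V) (hv : v ∉ S) :
      ∑ a ∈ S, (G.neighborFinset a ∩ G.neighborFinset v).card = S.card * (m ^ 2 + m) :=
    sum_const_nat fun a ha => h.card_neighborFinset_inter (by rintro rfl; exact hv ha)
  have edge_eq : ((m : ℤ) ^ 2 + m) * Q + (m ^ 2 - 1) * R + (m ^ 2 + m) = (m ^ 2 + m) ^ 2 := by
    set A := G.neighborFinset x ∩ G.neighborFinset y with hA
    have cA : A.card = m ^ 2 + m := h.card_neighborFinset_inter hyx.symm
    have hAx : A ⊆ G.neighborFinset x := inter_subset_left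
    have hyB : y ∈ G.neighborFinset x \ A := by simp [hA, hadj]
    have h1 := sum_card_neighborFinset_inter_comm G A (G.neighborFinset x)
    rw [hpair A x (by simp [hA]), cA, ← sum_sdiff hAx,
      ← add_sum_erase _ _ hyB,
      sum_const_nat (s := A) (m := Q), sum_const_nat (m := R), cA,
      inter_eq_right.2 (inter_subset_right : A ⊆ _), cA, card_erase_of_mem hyB] at h1
    · have h2 := card_sdiff_add_card_eq_card hAx
      rw [cA, hdeg] at h2
      have h3 : (G.neighborFinset x \ A).card = m ^ 2 := by omega
      have h4 : 1 ≤ m ^ 2 := Nat.one_le_pow _ _ (by omega)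
      rw [h3] at h1
      zify [h4] at h1
      linarith
    · intro v hv
      simp only [hA, mem_erase, mem_sdiff, mem_inter, SimpleGraph.mem_neighborFinset] at hv
      refine hR v hv.2.1.ne' hv.1 (Or.inl ⟨hv.2.1.symm, fun hvy => hv.2.2 ⟨hv.2.1, hvy.symm⟩⟩)
    · intro v hv
      simp only [hA, mem_inter, SimpleGraph.mem_neighborFinset] at hv
      exact hQ v hv.1.ne' hv.2.ne' hv.1.symm hv.2.symm
  set C := G.neighborFinset x ∩ G.neighborFinset z with hC
  set D := G.neighborFinset x \ C with hD
  set S := (G.neighborFinset x ∪ G.neighborFinset z)ᶜ with hS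
  have cC : C.card = m ^ 2 + m := h.card_neighborFinset_inter hne
  have hCx : C ⊆ G.neighborFinset x := inter_subset_left
  have cD : D.card = m ^ 2 := by
    have h2 := card_sdiff_add_card_eq_card hCx
    rw [cC, hdeg, ← hD] at h2
    omega
  have cS : (S.card : ℤ) = m ^ 2 - m := by
    have h1 := card_union_add_card_inter (G.neighborFinset x) (G.neighborFinset z)
    have h2 := card_compl_add_card (G.neighborFinset x ∪ G.neighborFinset z)
    rw [← hC, cC, hdeg, hdeg] at h1
    rw [← hS, h.card] at h2
    zify at h1 h2
    linarith
  have hDW : ∀ v ∈ D, (G.neighborFinset v ∩ C).card = W := by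
    intro v hv
    simp only [hD, hC, mem_sdiff, mem_inter, SimpleGraph.mem_neighborFinset] at hv
    exact hW v hv.1.ne' (by rintro rfl; exact hnadj hv.1)
      (Or.inl ⟨hv.1.symm, fun hvz => hv.2 ⟨hv.1, hvz.symm⟩⟩)
  have sumC : ∑ v ∈ C, (G.neighborFinset v ∩ C).card = (m ^ 2 + m) * R := by
    rw [sum_const_nat (m := R), cC]
    intro v hv
    simp only [hC, mem_inter, SimpleGraph.mem_neighborFinset] at hv
    exact hR' v hv.1.ne' hv.2.ne' hv.1.symm hv.2.symm
  have sumx := sum_card_neighborFinset_inter_comm G C (G.neighborFinset x)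
  have sumz := sum_card_neighborFinset_inter_comm G C (G.neighborFinset z)
  have sumu := sum_card_neighborFinset_inter_comm G C univ
  rw [hpair C x (by simp [hC]), cC] at sumx
  rw [hpair C z (by simp [hC]), cC] at sumz
  simp only [inter_univ, hdeg, sum_const, smul_eq_mul, cC] at sumu
  have nonedge_eq : ((m : ℤ) ^ 2 + m) * R + m ^ 2 * W = (m ^ 2 + m) ^ 2 := by
    have h1 := sumx
    rw [← sum_sdiff (inter_subset_left : C ⊆ _), sumC, sum_const_nat hDW, cD] at h1
    zify at h1
    linarith
  have hxS : x ∈ S := by simp [hS, G.adj_comm z x, hnadj]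
  have hzS : z ∈ S.erase x := by simp [hS, hnadj, hne.symm]
  have hSV : ∀ v ∈ (S.erase x).erase z, (G.neighborFinset v ∩ C).card = Vp := by
    intro v hv
    simp only [hS, mem_erase, mem_compl, mem_union, SimpleGraph.mem_neighborFinset,
      not_or] at hv
    exact hV v hv.2.1 hv.1 (fun hvx => hv.2.2.1 hvx.symm) (fun hvz => hv.2.2.2 hvz.symm)
  have cS' : (((S.erase x).erase z).card : ℤ) = m ^ 2 - m - 2 := by
    have h1 := card_erase_add_one hxS
    have h2 := card_erase_add_one hzS
    omega
  have hm' : (3 : ℤ) ≤ m := by exact_mod_cast hm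
  have outer_eq : 2 * ((m : ℤ) ^ 2 + m) + (m ^ 2 - m - 2) * Vp =
      (2 * m ^ 2 + m) * (m ^ 2 + m) - 2 * (m ^ 2 + m) ^ 2 + (m ^ 2 + m) * R := by
    have h1 := sum_union_inter (s₁ := G.neighborFinset x) (s₂ := G.neighborFinset z)
      (f := fun v => (G.neighborFinset v ∩ C).card)
    rw [← hC, sumC, sumx, sumz] at h1
    rw [← sum_compl_add_sum (G.neighborFinset x ∪ G.neighborFinset z), ← hS,
      ← add_sum_erase _ _ hxS, ← add_sum_erase _ _ hzS, sum_const_nat hSV,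
      inter_eq_right.2 (inter_subset_left : C ⊆ _),
      inter_eq_right.2 (inter_subset_right : C ⊆ _), cC] at sumu
    zify at h1 sumu
    rw [cS'] at sumu
    linarith
  have hVle : (Vp : ℤ) ≤ m ^ 2 + m := by
    obtain ⟨v, hv⟩ : ((S.erase x).erase z).Nonempty := by
      rw [← card_pos]
      zify
      rw [cS']
      nlinarith
    have h1 := card_le_card (inter_subset_right : G.neighborFinset v ∩ C ⊆ C)
    rw [hSV v hv, cC] at h1
    exact_mod_cast h1
  rcases isoreg_parameter_cases hodd hm edge_eq nonedge_eq outer_eq hVle with rfl | rfl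
  · have hindep : ∀ v ∈ S, (G.neighborFinset v ∩ S).card = 0 := by
      intro v hv
      have hsub : G.neighborFinset v ⊆ G.neighborFinset x ∪ G.neighborFinset z := by
        by_cases hvx : v = x
        · rw [hvx]; exact subset_union_left
        by_cases hvz : v = z
        · rw [hvz]; exact subset_union_right
        have h1 := hSV v (mem_erase.2 ⟨hvz, mem_erase.2 ⟨hvx, hv⟩⟩)
        have h2 := card_union_add_card_inter (G.neighborFinset v ∩ G.neighborFinset x)
          (G.neighborFinset v ∩ G.neighborFinset z)
        rw [← inter_union_distrib_left, ← inter_inter_distrib_left, ← hC, h1,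
          h.card_neighborFinset_inter hvx, h.card_neighborFinset_inter hvz] at h2
        refine inter_eq_left.1 (eq_of_subset_of_card_le inter_subset_left ?_)
        rw [hdeg]
        omega
      rw [card_eq_zero, ← disjoint_iff_inter_eq_empty, hS]
      exact disjoint_compl_right.mono_left hsub
    have hb := h.regular_induced_bound S hindep
    rw [cS] at hb
    push_cast at hb
    exact hb.not_gt (coclique_size_violates_bound hm')
  · have hxD : x ∉ D := by simp [hD]
    have cK : (insert x D).card = m ^ 2 + 1 := by rw [card_insert_of_notMem hxD, cD]
    have hclique : ∀ v ∈ insert x D, (G.neighborFinset v ∩ insert x D).card = m ^ 2 := by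
      intro v hv
      rcases mem_insert.1 hv with rfl | hv
      · rw [inter_insert_of_notMem (by simp), inter_eq_right.2 sdiff_subset, cD]
      · have hvx : G.Adj v x := by
          simp only [hD, mem_sdiff, SimpleGraph.mem_neighborFinset] at hv
          exact hv.1.symm
        have h1 := h.card_neighborFinset_inter hvx.ne
        rw [← sdiff_union_of_subset hCx, ← hD,
          inter_union_distrib_left, card_union_of_disjoint, hDW v hv] at h1
        · rw [inter_insert_of_mem (by simpa using hvx),
            card_insert_of_notMem (by simp [hxD])]
          omega
        · exact disjoint_sdiff_self_left.mono inter_subset_right inter_subset_right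
    have hb := h.regular_induced_bound _ hclique
    rw [cK] at hb
    push_cast at hb
    exact hb.not_gt (clique_size_violates_bound hm')
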